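/- Let K be a field and k ≥ 1. A tuple (q₁,…,q_k) of infinite linear forms in (S¹_∞)^{⊕k}, identified with a full-column-rank ℕ×k matrix A, can be mapped by an element of the row-finite substitution monoid E to the standard tuple (x₁,…,x_k); moreover the element of E can be chosen invertible in E. Consequently any two k-tuples of linearly independent infinite linear forms are equivalent under mutual specialisation. -/

import Mathlib

/-- A matrix `e : ℕ × ℕ → K` is row-finite when each row has finitely many nonzero entries;
these matrices form the monoid `E` acting on infinite linear forms by
`(e · c) i = Σ_j e i j * c j`. -/
def RowFinite {K : Type*} [Zero K] (e : ℕ → ℕ → K) : Prop :=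
  ∀ i, (Function.support (e i)).Finite

theorem aux_surj {K : Type*} [Field K] {k : ℕ}
    (q : Fin k → (ℕ → K)) (hq : LinearIndependent K q) :
    Function.Surjective (Finsupp.linearCombination K (fun (j : ℕ) (l : Fin k) => q l j)) := by
  rw [← LinearMap.range_eq_top]
  by_contra h
  obtain ⟨f, hf, hle⟩ := Submodule.exists_le_ker_of_lt_top _ (lt_top_iff_ne_top.2 h)
  apply hf
  have key : ∀ l, f (Pi.single l 1) = 0 := by
    rw [Fintype.linearIndependent_iff] at hq
    apply hq
    funext j
    have h1 : f (fun l => q l j) = 0 := by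
      have : (fun l => q l j) ∈ LinearMap.range
          (Finsupp.linearCombination K (fun (j : ℕ) (l : Fin k) => q l j)) :=
        ⟨Finsupp.single j 1, by simp⟩
      exact hle this
    rw [LinearMap.pi_apply_eq_sum_univ f] at h1
    simp only [Finset.sum_apply, Pi.smul_apply, smul_eq_mul, Pi.zero_apply]
    rw [← h1]
    refine Finset.sum_congr rfl fun l _ => ?_
    rw [smul_eq_mul, mul_comm]
    congr 2
    funext m
    simp [Pi.single_apply, eq_comm]
  apply LinearMap.pi_ext'
  intro l
  ext
  simp [key l]

theorem aux_basis {K : Type*} [Field K] {k : ℕ} (Q : (ℕ →₀ K) →ₗ[K] (Fin k → K))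
    (hQ : Function.Surjective Q) :
    ∃ b : Module.Basis ℕ K (ℕ →₀ K), ∀ i l, Q (b i) l = if i = l.1 then 1 else 0 := by
  obtain ⟨s, hs⟩ := Q.exists_rightInverse_of_surjective (LinearMap.range_eq_top.2 hQ)
  have hs' : ∀ a, Q (s a) = a := fun a => by
    simpa using congrArg (fun g => g a) hs
  let N := LinearMap.ker Q
  have hrank : Module.rank K N = Cardinal.aleph0 := by
    have h1 := LinearMap.rank_range_add_rank_ker Q
    rw [LinearMap.range_eq_top.2 hQ, rank_top, rank_fin_fun, rank_finsupp_self] at h1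
    have h1 : (k : Cardinal) + Module.rank K N = Cardinal.aleph0 := by simpa using h1
    apply le_antisymm
    · rw [← h1]; exact self_le_add_left _ _
    · by_contra hlt
      rw [not_le] at hlt
      exact absurd h1 (Cardinal.add_lt_aleph0 (Cardinal.natCast_lt_aleph0) hlt).ne
  let b0 := Module.Basis.ofVectorSpace K N
  have hc := b0.mk_eq_rank''
  rw [hrank] at hc
  obtain ⟨hden⟩ := Cardinal.denumerable_iff.2 hc
  let σ := Denumerable.eqv (Module.Basis.ofVectorSpaceIndex K N)
  let bN : Module.Basis ℕ K N := b0.reindex σ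
  let F : ((Fin k → K) × N) ≃ₗ[K] (ℕ →₀ K) :=
    LinearEquiv.ofBijective (s.coprod N.subtype) (by
      constructor
      · rintro ⟨a, n⟩ ⟨a', n'⟩ h
        have h : s a + (n : ℕ →₀ K) = s a' + (n' : ℕ →₀ K) := by simpa using h
        have hn : Q n = 0 := n.2
        have hn' : Q n' = 0 := n'.2
        have ha : a = a' := by
          have := congrArg Q h
          rwa [map_add, map_add, hs', hs', hn, hn', add_zero, add_zero] at this
        subst ha
        have : n = n' := Subtype.ext (add_left_cancel h)
        rw [this]
      · intro v
        refine ⟨(Q v, ⟨v - s (Q v), ?_⟩), ?_⟩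
        · change Q _ = 0
          rw [map_sub, hs', sub_self]
        · simp)
  have hF : ∀ x, Q (F x) = x.1 := by
    rintro ⟨a, n⟩
    have hn : Q n = 0 := n.2
    change Q (s.coprod N.subtype (a, n)) = a
    simp [hs', hn]
  let B := (((Pi.basisFun K (Fin k)).prod bN).map F)
  refine ⟨B.reindex (finSumNatEquiv k), fun i l => ?_⟩
  obtain ⟨j, rfl⟩ := (finSumNatEquiv k).surjective i
  rw [Module.Basis.reindex_apply, Equiv.symm_apply_apply, Module.Basis.map_apply, hF]
  cases j with
  | inl j => simp [Pi.single_apply, Fin.ext_iff, eq_comm]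
  | inr j =>
    have := l.2
    have h2 : (finSumNatEquiv k) (Sum.inr j) = k + j ∨ (finSumNatEquiv k) (Sum.inr j) = j + k := by
      first | exact Or.inl rfl | exact Or.inr rfl
    rw [if_neg (by omega)]
    simp

/-- Any `k`-tuple of linearly independent infinite linear forms (equivalently, an `ℕ × k`
coefficient matrix of full column rank) can be mapped by an element of the row-finite
substitution monoid `E` — which can moreover be chosen invertible in `E` — to the standard
tuple `(x₀, …, x_{k-1})`. -/
theorem stmt18 (K : Type*) [Field K] (k : ℕ) (hk : 1 ≤ k)
    (q : Fin k → (ℕ → K)) (hq : LinearIndependent K q) :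
    ∃ e : ℕ → ℕ → K, RowFinite e ∧
      (∃ e' : ℕ → ℕ → K, RowFinite e' ∧
        (∀ i j : ℕ, ∑ᶠ m : ℕ, e i m * e' m j = if i = j then 1 else 0) ∧
        (∀ i j : ℕ, ∑ᶠ m : ℕ, e' i m * e m j = if i = j then 1 else 0)) ∧
      ∀ l : Fin k, (fun i : ℕ => ∑ᶠ j : ℕ, e i j * q l j)
        = fun i : ℕ => if i = l.1 then 1 else 0 := by
  obtain ⟨b, hb⟩ := aux_basis _ (aux_surj q hq)
  have fs : ∀ (v : ℕ →₀ K) (g : ℕ → K), ∑ᶠ m, v m * g m = v.sum fun m a => a * g m := by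
    intro v g
    apply finsum_eq_sum_of_support_subset
    intro m hm
    simp only [Function.mem_support] at hm
    simpa using left_ne_zero_of_mul hm
  refine ⟨fun i m => b i m, fun i => (b i).finite_support,
    ⟨fun m j => b.repr (Finsupp.single m 1) j, fun m => (b.repr _).finite_support, ?_, ?_⟩, ?_⟩
  · intro i j
    rw [fs]
    have h : b.repr (b i) j = if i = j then 1 else 0 := by
      rw [b.repr_self, Finsupp.single_apply]
    rw [← h]
    conv_rhs => rw [← Finsupp.sum_single (b i)]
    rw [Finsupp.sum, Finsupp.sum, map_sum, Finsupp.finsetSum_apply]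
    refine Finset.sum_congr rfl fun m _ => ?_
    rw [← mul_one (b i m), ← smul_eq_mul (b i m) 1, ← Finsupp.smul_single, map_smul]
    simp
  · intro i j
    rw [fs _ (fun m => b m j)]
    have h : (Finsupp.single i (1 : K)) j = if i = j then 1 else 0 := Finsupp.single_apply
    rw [← h]
    conv_rhs => rw [← b.linearCombination_repr (Finsupp.single i (1 : K))]
    rw [Finsupp.linearCombination_apply, Finsupp.sum, Finsupp.sum, Finsupp.finsetSum_apply]
    simp
  · intro l
    funext i
    rw [fs _ (q l), ← hb i l, Finsupp.linearCombination_apply, Finsupp.sum, Finsupp.sum,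
      Finset.sum_apply]
    simp
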